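/- arXiv:2009.01024 — 2 statements merged into one kernel-verified Lean document; each statement's English description precedes it below -/
import Mathlib

section
/- The generating function μ(1212,z) = Σ_{n≥2} |μ_n(1212)| z^n of matchings minimally containing 1212 satisfies μ(1212,z) = z(C(z)-1) / ((1-2zC(z))(1-zC(z))), where C(z) is the generating function of the Catalan numbers (satisfying C(z) = 1 + zC(z)^2). -/
/-- A (perfect) matching on `Fin m`: a fixed-point-free involution. -/
def IsMatching {m : ℕ} (f : Fin m → Fin m) : Prop :=
  Function.Involutive f ∧ ∀ i, f i ≠ i

/-- The pattern `σ` occurs in `τ`. -/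
def Occurs {m M : ℕ} (σ : Fin m → Fin m) (τ : Fin M → Fin M) : Prop :=
  ∃ g : Fin m → Fin M, StrictMono g ∧ ∀ p, τ (g p) = g (σ p)

def Avoids {m M : ℕ} (σ : Fin m → Fin m) (τ : Fin M → Fin M) : Prop :=
  ¬ Occurs σ τ

def juxt {m M : ℕ} (σ : Fin m → Fin m) (τ : Fin M → Fin M) :
    Fin (m + M) → Fin (m + M) :=
  fun i => finSumFinEquiv (Sum.map σ τ (finSumFinEquiv.symm i))

def liftMatching {m : ℕ} (σ : Fin m → Fin m) : Fin (m + 2) → Fin (m + 2) := fun i =>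
  if _ : i.val = 0 then ⟨m + 1, by omega⟩
  else if _ : i.val = m + 1 then ⟨0, by omega⟩
  else ⟨(σ ⟨i.val - 1, by have := i.isLt; omega⟩).val + 1, by
    have := (σ ⟨i.val - 1, by have := i.isLt; omega⟩).isLt; omega⟩

/-- `τ` contains `σ`, but deleting the rightmost edge of `τ` (the edge containing the
last vertex) destroys every occurrence of `σ`. -/
def MinContains {m M : ℕ} (σ : Fin m → Fin m) (τ : Fin M → Fin M) : Prop :=
  Occurs σ τ ∧ ¬ ∃ g : Fin m → Fin M, StrictMono g ∧ (∀ p, τ (g p) = g (σ p)) ∧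
    ∀ p, (g p : ℕ) ≠ M - 1 ∧ (τ (g p) : ℕ) ≠ M - 1

def ConnectedMatching {m : ℕ} (f : Fin m → Fin m) : Prop :=
  0 < m ∧ ¬ ∃ h : ℕ, 0 < h ∧ h < m ∧ ∀ i : Fin m, ((i : ℕ) < h ↔ ((f i : ℕ) < h))

def HasCrossing {m : ℕ} (f : Fin m → Fin m) : Prop :=
  ∃ a b : Fin m, a < b ∧ b < f a ∧ f a < f b

def p1122 : Fin 4 → Fin 4 := ![1, 0, 3, 2]
def p1212 : Fin 4 → Fin 4 := ![2, 3, 0, 1]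
def p1221 : Fin 4 → Fin 4 := ![3, 2, 1, 0]

/-- The involutions of `ℕ` whose set of non-fixed points is `S`. -/
def matchingsOn (S : Finset ℕ) : Set (ℕ → ℕ) :=
  {f | Function.Involutive f ∧ ∀ i, f i ≠ i ↔ i ∈ S}

def Crosses (f : ℕ → ℕ) : Prop :=
  ∃ a b, a < b ∧ b < f a ∧ f a < f b

def noncrossingOn (S : Finset ℕ) : Set (ℕ → ℕ) :=
  {f | f ∈ matchingsOn S ∧ ¬ Crosses f}

def eraseEdge (l : ℕ) (f : ℕ → ℕ) : ℕ → ℕ := fun i =>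
  if i = l ∨ i = f l then i else f i

def addEdge (a b : ℕ) (f : ℕ → ℕ) : ℕ → ℕ := fun i =>
  if i = a then b else if i = b then a else f i

lemma matchingsOn_apply_mem {S : Finset ℕ} {f : ℕ → ℕ} (hf : f ∈ matchingsOn S) {i : ℕ}
    (hi : i ∈ S) : f i ∈ S := by
  have h := hf.1 i
  have h1 := (hf.2 i).2 hi
  rw [← hf.2]
  grind

lemma matchingsOn_apply_eq {S : Finset ℕ} {f : ℕ → ℕ} (hf : f ∈ matchingsOn S) {i : ℕ}
    (hi : i ∉ S) : f i = i := by
  by_contra h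
  exact hi ((hf.2 i).1 h)

lemma finite_matchingsOn (S : Finset ℕ) : (matchingsOn S).Finite := by
  have : Finite (matchingsOn S) := by
    refine Finite.of_injective
      (fun f : matchingsOn S => fun i : S => (⟨f.1 i, matchingsOn_apply_mem f.2 i.2⟩ : S)) ?_
    rintro ⟨f, hf⟩ ⟨g, hg⟩ h
    ext i
    by_cases hi : i ∈ S
    · exact congrArg Subtype.val (congrFun h ⟨i, hi⟩)
    · exact (matchingsOn_apply_eq hf hi).trans (matchingsOn_apply_eq hg hi).symm
  exact Set.toFinite _

lemma finite_noncrossingOn (S : Finset ℕ) : (noncrossingOn S).Finite :=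
  (finite_matchingsOn S).subset fun _ h => h.1

/-- Transport along a map `u`, with inverse `v`, onto a set `T`. -/
def transport (T : Finset ℕ) (u v f : ℕ → ℕ) : ℕ → ℕ := fun j =>
  if j ∈ T then u (f (v j)) else j

lemma transport_mem {S T : Finset ℕ} {u v : ℕ → ℕ} (hu : ∀ i ∈ S, u i ∈ T)
    (hv : ∀ j ∈ T, v j ∈ S) (hvu : ∀ i ∈ S, v (u i) = i) (huv : ∀ j ∈ T, u (v j) = j)
    (hmono : ∀ i ∈ S, ∀ j ∈ S, u i < u j → i < j) {f : ℕ → ℕ} (hf : f ∈ noncrossingOn S) :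
    transport T u v f ∈ noncrossingOn T := by
  have hm := hf.1
  have hS : ∀ i ∈ S, f i ∈ S := fun i hi => matchingsOn_apply_mem hm hi
  have hinv := hm.1
  refine ⟨⟨fun j => ?_, fun j => ?_⟩, ?_⟩
  · by_cases hj : j ∈ T
    · have h1 := hinv (v j)
      simp only [transport]
      grind
    · simp [transport, hj]
  · by_cases hj : j ∈ T
    · have h1 := (hm.2 (v j)).2 (hv j hj)
      simp only [transport]
      grind
    · simp [transport, hj]
  · rintro ⟨a, b, hab, hb, hfb⟩
    by_cases ha : a ∈ T
    swap
    · simp only [transport, ha, if_false] at hb; omega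
    by_cases hbT : b ∈ T
    swap
    · simp only [transport, ha, if_true, hbT, if_false] at hb hfb; omega
    simp only [transport, ha, if_true, hbT] at hb hfb
    refine hf.2 ⟨v a, v b, ?_, ?_, ?_⟩
    · exact hmono _ (hv a ha) _ (hv b hbT) (by rw [huv a ha, huv b hbT]; exact hab)
    · exact hmono _ (hv b hbT) _ (hS _ (hv a ha)) (by rw [huv b hbT]; exact hb)
    · exact hmono _ (hS _ (hv a ha)) _ (hS _ (hv b hbT)) hfb

lemma transport_transport {S T : Finset ℕ} {u v : ℕ → ℕ} (hu : ∀ i ∈ S, u i ∈ T)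
    (hvu : ∀ i ∈ S, v (u i) = i) {f : ℕ → ℕ} (hf : f ∈ noncrossingOn S) :
    transport S v u (transport T u v f) = f := by
  ext i
  by_cases hi : i ∈ S
  · simp [transport, hi, hu i hi, hvu i hi, hvu _ (matchingsOn_apply_mem hf.1 hi)]
  · simp [transport, hi, matchingsOn_apply_eq hf.1 hi]

lemma ncard_noncrossingOn_congr {S T : Finset ℕ} {u v : ℕ → ℕ} (hu : ∀ i ∈ S, u i ∈ T)
    (hv : ∀ j ∈ T, v j ∈ S) (hvu : ∀ i ∈ S, v (u i) = i) (huv : ∀ j ∈ T, u (v j) = j)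
    (hmono : ∀ i ∈ S, ∀ j ∈ S, i < j → u i < u j) :
    (noncrossingOn S).ncard = (noncrossingOn T).ncard := by
  have hmono' : ∀ i ∈ S, ∀ j ∈ S, u i < u j → i < j := by
    intro i hi j hj h
    rcases lt_trichotomy i j with h1 | h1 | h1
    · exact h1
    · subst h1; omega
    · have := hmono j hj i hi h1; omega
  have hmono'' : ∀ i ∈ T, ∀ j ∈ T, v i < v j → i < j := by
    intro i hi j hj h
    have := hmono _ (hv i hi) _ (hv j hj) h
    rwa [huv i hi, huv j hj] at this
  refine Set.ncard_congr (fun f _ => transport T u v f)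
    (fun f hf => transport_mem hu hv hvu huv hmono' hf) (fun f g hf hg h => ?_) (fun g hg => ?_)
  · rw [← transport_transport hu hvu hf, ← transport_transport hu hvu hg, h]
  · exact ⟨transport S v u g, transport_mem hv hu huv hvu hmono'' hg,
      transport_transport hv huv hg⟩

/-- The number of noncrossing perfect matchings of `m` points. -/
noncomputable def noncrossingCount (m : ℕ) : ℕ := (noncrossingOn (Finset.range m)).ncard

lemma ncard_noncrossingOn_Ioo (a m : ℕ) :
    (noncrossingOn (Finset.Ioo a (a + m + 1))).ncard = noncrossingCount m := by
  refine ncard_noncrossingOn_congr (u := fun i => i - (a + 1)) (v := fun i => i + (a + 1))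
    ?_ ?_ ?_ ?_ ?_ <;> simp only [Finset.mem_Ioo, Finset.mem_range] <;> grind

lemma ncard_noncrossingOn_erase {k m : ℕ} (hk : k ≤ m) :
    (noncrossingOn ((Finset.range (m + 1)).erase k)).ncard = noncrossingCount m := by
  refine ncard_noncrossingOn_congr (u := fun i => if i < k then i else i - 1)
    (v := fun i => if i < k then i else i + 1)
    ?_ ?_ ?_ ?_ ?_ <;> simp only [Finset.mem_erase, Finset.mem_range] <;> grind

lemma ncard_eq_sum_fiber {α : Type*} {A : Set α} (hA : A.Finite) (p : α → ℕ) (m : ℕ)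
    (hp : ∀ f ∈ A, p f < m) :
    A.ncard = ∑ k ∈ Finset.range m, {f | f ∈ A ∧ p f = k}.ncard := by
  classical
  rw [Set.ncard_eq_toFinset_card A hA, Finset.card_eq_sum_card_fiberwise (f := p)
    (t := Finset.range m) (fun f hf => by simpa using hp f (by simpa using hf))]
  refine Finset.sum_congr rfl fun k _ => ?_
  rw [← Set.ncard_coe_finset]
  congr 1
  ext f
  simp

lemma Crosses.of_eraseEdge {l : ℕ} {f : ℕ → ℕ} (h : Crosses (eraseEdge l f)) : Crosses f := by
  obtain ⟨a, b, h1, h2, h3⟩ := h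
  refine ⟨a, b, ?_⟩
  simp only [eraseEdge] at h2 h3
  grind

def almostNoncrossing (m : ℕ) : Set (ℕ → ℕ) :=
  {f | f ∈ matchingsOn (Finset.range (m + 2)) ∧ ¬ Crosses (eraseEdge (m + 1) f)}

lemma ncard_almostNoncrossing_fiber {k m : ℕ} (hk : k < m + 1) :
    {f | f ∈ almostNoncrossing m ∧ f (m + 1) = k}.ncard = noncrossingCount m := by
  rw [← ncard_noncrossingOn_erase (k := k) (m := m) (by omega)]
  refine Set.ncard_congr (fun f _ => eraseEdge (m + 1) f) ?_ ?_ ?_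
  · rintro f ⟨⟨⟨h1, h2⟩, h3⟩, h4⟩
    refine ⟨⟨fun i => ?_, fun i => ?_⟩, h3⟩
    · have := h1 i
      have := h1 (m + 1)
      simp only [eraseEdge]
      grind
    · have := h2 i
      have := h1 i
      simp only [eraseEdge, Finset.mem_erase, Finset.mem_range] at *
      grind
  · rintro f g ⟨⟨⟨h1, h2⟩, h3⟩, h4⟩ ⟨⟨⟨h1', h2'⟩, h3'⟩, h4'⟩ h
    ext i
    have := congrFun h i
    have := h1 (m + 1)
    have := h1' (m + 1)
    simp only [eraseEdge] at *
    grind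
  · rintro g ⟨⟨h1, h2⟩, h3⟩
    have hk' : g k = k := by
      have := h2 k
      simp at this
      exact this
    have hm : g (m + 1) = m + 1 := by
      have := h2 (m + 1)
      simp at this
      exact this
    have hE : eraseEdge (m + 1) (addEdge k (m + 1) g) = g := by
      ext i
      simp only [eraseEdge, addEdge]
      grind
    refine ⟨addEdge k (m + 1) g, ⟨⟨⟨fun i => ?_, fun i => ?_⟩, by rwa [hE]⟩, ?_⟩, hE⟩
    · have := h1 i
      simp only [addEdge]
      grind
    · have := h2 i
      simp only [addEdge, Finset.mem_erase, Finset.mem_range] at *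
      grind
    · simp only [addEdge]
      grind

lemma finite_almostNoncrossing (m : ℕ) : (almostNoncrossing m).Finite :=
  (finite_matchingsOn _).subset fun _ h => h.1

lemma ncard_almostNoncrossing (m : ℕ) :
    (almostNoncrossing m).ncard = (m + 1) * noncrossingCount m := by
  rw [ncard_eq_sum_fiber (finite_almostNoncrossing m) (fun f => f (m + 1)) (m + 1)]
  · rw [Finset.sum_congr rfl fun k hk =>
      ncard_almostNoncrossing_fiber (m := m) (Finset.mem_range.1 hk)]
    simp
  · rintro f ⟨hf, -⟩
    have h1 := matchingsOn_apply_mem hf (i := m + 1) (by simp)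
    have h2 := (hf.2 (m + 1)).2 (by simp)
    simp at h1
    omega

/-- The matching joining `0` to `c` and following `g` below `c` and `h` above `c`. -/
def nestJoin (c : ℕ) (g h : ℕ → ℕ) : ℕ → ℕ := fun i =>
  if i = 0 then c else if i = c then 0 else if i < c then g i else h i

lemma ncard_noncrossingOn_fiber {k m : ℕ} (hk : k < m + 1) :
    {f | f ∈ noncrossingOn (Finset.range (m + 2)) ∧ f 0 - 1 = k}.ncard =
      noncrossingCount k * noncrossingCount (m - k) := by
  have e1 := ncard_noncrossingOn_Ioo 0 k
  have e2 := ncard_noncrossingOn_Ioo (k + 1) (m - k)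
  rw [show 0 + k + 1 = k + 1 by omega] at e1
  rw [show k + 1 + (m - k) + 1 = m + 2 by omega] at e2
  rw [← e1, ← e2, ← Set.ncard_prod]
  symm
  refine Set.ncard_congr (fun p _ => nestJoin (k + 1) p.1 p.2) ?_ ?_ ?_
  · rintro ⟨g, h⟩ ⟨hg, hh⟩
    simp only at hg hh
    have g1 := hg.1.1
    have g2 := fun i => matchingsOn_apply_mem hg.1 (i := i)
    have g3 := hg.1.2
    have h1 := hh.1.1
    have h2 := fun i => matchingsOn_apply_mem hh.1 (i := i)
    have h3 := hh.1.2
    simp only [Finset.mem_Ioo] at g2 g3 h2 h3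
    refine ⟨⟨⟨fun i => ?_, fun i => ?_⟩, ?_⟩, ?_⟩
    · have := g1 i
      have := h1 i
      have := g2 i
      have := h2 i
      have := h3 i
      simp only [nestJoin]
      grind
    · have := g3 i
      have := h3 i
      simp only [nestJoin, Finset.mem_range]
      grind
    · rintro ⟨a, b, hab, hb, hc⟩
      by_cases hak : a ≤ k
      · have := g2 a
        have := g2 b
        have hn := hg.2
        simp only [Crosses, not_exists] at hn
        have := hn a b
        simp only [nestJoin] at hb hc
        grind
      · have hn := hh.2
        simp only [Crosses, not_exists] at hn
        have := hn a b
        simp only [nestJoin] at hb hc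
        grind
    · simp [nestJoin]
  · rintro ⟨g, h⟩ ⟨g', h'⟩ ⟨hg, hh⟩ ⟨hg', hh'⟩ he
    simp only at hg hh hg' hh' he
    have g3 := hg.1.2
    have h3 := hh.1.2
    have g3' := hg'.1.2
    have h3' := hh'.1.2
    simp only [Finset.mem_Ioo] at g3 h3 g3' h3'
    rw [Prod.mk.injEq]
    constructor
    · ext i
      have := congrFun he i
      have := g3 i
      have := g3' i
      simp only [nestJoin] at *
      grind
    · ext i
      have := congrFun he i
      have := h3 i
      have := h3' i
      simp only [nestJoin] at *
      grind
  · rintro f ⟨hf, hk0⟩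
    have f1 := hf.1.1
    have f2 := fun i => matchingsOn_apply_mem hf.1 (i := i)
    have f3 := hf.1.2
    have f4 := hf.2
    simp only [Crosses, not_exists] at f4
    simp only [Finset.mem_range] at f2 f3
    have hf0 : f 0 = k + 1 := by
      have := f3 0
      grind
    have hfk : f (k + 1) = 0 := by rw [← hf0, f1]
    have below : ∀ i, 0 < i → i < k + 1 → 0 < f i ∧ f i < k + 1 := by
      intro i hi1 hi2
      have := f4 0 i
      have := f1 i
      grind
    have above : ∀ i, k + 1 < i → k + 1 < f i := by
      intro i hi
      have := below (f i)
      have := f1 i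
      grind
    refine ⟨(fun i => if i < k + 1 ∧ 0 < i then f i else i, fun i => if k + 1 < i then f i else i),
      ⟨⟨⟨fun i => ?_, fun i => ?_⟩, ?_⟩, ⟨⟨fun i => ?_, fun i => ?_⟩, ?_⟩⟩, ?_⟩
    · have := f1 i
      grind
    · have := f3 i
      simp only [Finset.mem_Ioo]
      grind
    · rintro ⟨a, b, hab, hb, hc⟩
      have := f4 a b
      grind
    · have := f1 i
      grind
    · have := f3 i
      simp only [Finset.mem_Ioo]
      grind
    · rintro ⟨a, b, hab, hb, hc⟩
      have := f4 a b
      grind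
    · ext i
      simp only [nestJoin]
      grind

lemma noncrossingCount_add_two (m : ℕ) :
    noncrossingCount (m + 2) =
      ∑ k ∈ Finset.range (m + 1), noncrossingCount k * noncrossingCount (m - k) := by
  rw [noncrossingCount, ncard_eq_sum_fiber (finite_noncrossingOn _) (fun f => f 0 - 1) (m + 1)]
  · exact Finset.sum_congr rfl fun k hk => ncard_noncrossingOn_fiber (Finset.mem_range.1 hk)
  · rintro f ⟨hf, -⟩
    have h1 := matchingsOn_apply_mem hf (i := 0) (by simp)
    simp at h1
    omega

lemma noncrossingCount_zero : noncrossingCount 0 = 1 := by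
  rw [noncrossingCount, Set.ncard_eq_one]
  refine ⟨id, Set.eq_singleton_iff_unique_mem.2 ⟨⟨⟨fun _ => rfl, by simp⟩, ?_⟩, ?_⟩⟩
  · rintro ⟨a, b, h1, h2, h3⟩
    simp only [id] at h2
    omega
  · rintro f ⟨hf, -⟩
    ext i
    exact matchingsOn_apply_eq hf (by simp)

lemma noncrossingCount_one : noncrossingCount 1 = 0 := by
  rw [noncrossingCount, Set.ncard_eq_zero (finite_noncrossingOn _), Set.eq_empty_iff_forall_notMem]
  rintro f ⟨hf, -⟩
  have h1 := matchingsOn_apply_mem hf (i := 0) (by simp)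
  have h2 := (hf.2 0).2 (by simp)
  simp at h1
  exact h2 h1

lemma noncrossingCount_odd (n : ℕ) : noncrossingCount (2 * n + 1) = 0 := by
  induction n using Nat.strong_induction_on with
  | _ n ih =>
    rcases n with _ | n
    · exact noncrossingCount_one
    · rw [show 2 * (n + 1) + 1 = 2 * n + 1 + 2 by ring, noncrossingCount_add_two]
      refine Finset.sum_eq_zero fun k hk => ?_
      have hk := Finset.mem_range.1 hk
      rcases Nat.even_or_odd' k with ⟨c, rfl | rfl⟩
      · rw [show 2 * n + 1 - 2 * c = 2 * (n - c) + 1 by omega, ih (n - c) (by omega), mul_zero]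
      · rw [ih c (by omega), zero_mul]

lemma sum_range_eq_sum_even {F : ℕ → ℕ} (hF : ∀ i, F (2 * i + 1) = 0) (n : ℕ) :
    ∑ k ∈ Finset.range (2 * n + 1), F k = ∑ i ∈ Finset.range (n + 1), F (2 * i) := by
  induction n with
  | zero => simp
  | succ n ih =>
    rw [show 2 * (n + 1) + 1 = 2 * n + 1 + 1 + 1 by ring, Finset.sum_range_succ,
      Finset.sum_range_succ, ih, hF, Finset.sum_range_succ _ (n + 1)]
    simp [mul_add]

lemma noncrossingCount_even (n : ℕ) : noncrossingCount (2 * n) = catalan n := by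
  induction n using Nat.strong_induction_on with
  | _ n ih =>
    rcases n with _ | n
    · simpa using noncrossingCount_zero
    · rw [show 2 * (n + 1) = 2 * n + 2 by ring, noncrossingCount_add_two,
        sum_range_eq_sum_even fun i => by rw [noncrossingCount_odd, zero_mul], catalan_succ,
        Finset.sum_range]
      refine Finset.sum_congr rfl fun i _ => ?_
      rw [← Nat.mul_sub, ih i (by omega), ih (n - i) (by omega)]

/-- Extension of a self-map of `Fin m` to `ℕ` by the identity. -/
def extendFin {m : ℕ} (f : Fin m → Fin m) : ℕ → ℕ := fun i =>
  if h : i < m then f ⟨i, h⟩ else i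

lemma extendFin_val {m : ℕ} (f : Fin m → Fin m) (i : Fin m) : extendFin f i = f i := by
  simp [extendFin]

lemma extendFin_of_le {m : ℕ} (f : Fin m → Fin m) {i : ℕ} (h : m ≤ i) : extendFin f i = i := by
  simp [extendFin, h]

lemma extendFin_injective {m : ℕ} :
    Function.Injective (extendFin : (Fin m → Fin m) → ℕ → ℕ) := by
  intro f g h
  ext i
  rw [← extendFin_val f, h, extendFin_val]

lemma extendFin_mem_matchingsOn {m : ℕ} {f : Fin m → Fin m} (hf : IsMatching f) :
    extendFin f ∈ matchingsOn (Finset.range m) := by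
  refine ⟨fun i => ?_, fun i => ?_⟩ <;> rcases lt_or_ge i m with h | h
  · lift i to Fin m using h
    rw [extendFin_val, extendFin_val, hf.1]
  · rw [extendFin_of_le f h, extendFin_of_le f h]
  · lift i to Fin m using h
    simpa [extendFin_val, Fin.val_inj] using hf.2 i
  · simp [extendFin_of_le f h, h]

lemma exists_extendFin_eq {m : ℕ} {F : ℕ → ℕ} (hF : F ∈ matchingsOn (Finset.range m)) :
    ∃ f : Fin m → Fin m, IsMatching f ∧ extendFin f = F := by
  have hlt : ∀ i : Fin m, F i < m := fun i => by
    simpa using matchingsOn_apply_mem hF (i := i) (by simp)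
  refine ⟨fun i => ⟨F i, hlt i⟩, ⟨fun i => Fin.ext (hF.1 i), fun i h => ?_⟩, ?_⟩
  · exact (hF.2 i).2 (by simp) (congrArg Fin.val h)
  · ext i
    rcases lt_or_ge i m with h | h
    · simp [extendFin, h]
    · rw [extendFin_of_le _ h, matchingsOn_apply_eq hF (by simpa using h)]

lemma exists_p1212_iff {m : ℕ} {f : Fin m → Fin m} (hf : Function.Involutive f)
    (P : Fin m → Prop) :
    (∃ g : Fin 4 → Fin m, StrictMono g ∧ (∀ p, f (g p) = g (p1212 p)) ∧ ∀ p, P (g p)) ↔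
      ∃ a b, a < b ∧ b < f a ∧ f a < f b ∧ P a ∧ P b ∧ P (f a) ∧ P (f b) := by
  constructor
  · rintro ⟨g, hg, h, hP⟩
    have h0 : f (g 0) = g 2 := h 0
    have h1 : f (g 1) = g 3 := h 1
    refine ⟨g 0, g 1, hg (by decide), ?_, ?_, hP _, hP _, ?_, ?_⟩
    · rw [h0]; exact hg (by decide)
    · rw [h0, h1]; exact hg (by decide)
    · rw [h0]; exact hP _
    · rw [h1]; exact hP _
  · rintro ⟨a, b, h1, h2, h3, p1, p2, p3, p4⟩
    refine ⟨![a, b, f a, f b], Fin.strictMono_iff_lt_succ.2 ?_, ?_, ?_⟩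
    · simp [Fin.forall_fin_succ, h1, h2, h3]
    · simp [Fin.forall_fin_succ, p1212, hf a, hf b]
    · simp [Fin.forall_fin_succ, p1, p2, p3, p4]

lemma crosses_extendFin_iff {m : ℕ} (f : Fin m → Fin m) :
    Crosses (extendFin f) ↔ ∃ a b, a < b ∧ b < f a ∧ f a < f b := by
  constructor
  · rintro ⟨a, b, h1, h2, h3⟩
    have ha : a < m := by
      by_contra h
      rw [extendFin_of_le f (by omega)] at h2
      omega
    have hb : b < m := by
      by_contra h
      rw [extendFin_of_le f (i := b) (by omega)] at h3
      omega
    lift a to Fin m using ha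
    lift b to Fin m using hb
    simp only [extendFin_val] at h2 h3
    exact ⟨a, b, h1, h2, h3⟩
  · rintro ⟨a, b, h1, h2, h3⟩
    refine ⟨a, b, h1, ?_, ?_⟩ <;> simpa only [extendFin_val]

lemma crosses_eraseEdge_iff {f : ℕ → ℕ} (hf : Function.Involutive f) (l : ℕ) :
    Crosses (eraseEdge l f) ↔
      ∃ a b, a < b ∧ b < f a ∧ f a < f b ∧ (a ≠ l ∧ f a ≠ l) ∧ (b ≠ l ∧ f b ≠ l) := by
  refine exists_congr fun a => exists_congr fun b => ?_
  have := hf a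
  have := hf b
  have := hf l
  simp only [eraseEdge]
  grind

lemma minContains_p1212_iff {m : ℕ} {f : Fin m → Fin m} (hf : IsMatching f) :
    MinContains p1212 f ↔
      Crosses (extendFin f) ∧ ¬ Crosses (eraseEdge (m - 1) (extendFin f)) := by
  have h1 := exists_p1212_iff hf.1 fun _ => True
  have h2 := exists_p1212_iff hf.1 fun x => (x : ℕ) ≠ m - 1 ∧ (f x : ℕ) ≠ m - 1
  simp only [implies_true, and_true] at h1
  rw [MinContains, Occurs, h1, h2, crosses_extendFin_iff,
    crosses_eraseEdge_iff (extendFin_mem_matchingsOn hf).1]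
  refine and_congr_right fun _ => not_congr ⟨?_, ?_⟩
  · rintro ⟨a, b, h1, h2, h3, p1, p2, -, -⟩
    refine ⟨a, b, h1, ?_, ?_, ?_, ?_⟩ <;> simpa only [extendFin_val]
  · rintro ⟨a, b, h1, h2, h3, p1, p2⟩
    have ha : a < m := by
      by_contra h
      rw [extendFin_of_le f (by omega)] at h2
      omega
    have hb : b < m := by
      by_contra h
      rw [extendFin_of_le f (i := b) (by omega)] at h3
      omega
    lift a to Fin m using ha
    lift b to Fin m using hb
    simp only [extendFin_val] at h2 h3 p1 p2
    refine ⟨a, b, h1, h2, h3, p1, p2, ?_, ?_⟩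
    · rw [hf.1]; exact p1.symm
    · rw [hf.1]; exact p2.symm

lemma card_minContains_p1212_add (m : ℕ) :
    Nat.card {f : Fin (m + 2) → Fin (m + 2) // IsMatching f ∧ MinContains p1212 f} +
      noncrossingCount (m + 2) = (m + 1) * noncrossingCount m := by
  have hsub : noncrossingOn (Finset.range (m + 2)) ⊆ almostNoncrossing m :=
    fun f hf => ⟨hf.1, fun h => hf.2 h.of_eraseEdge⟩
  rw [← ncard_almostNoncrossing, ← Set.ncard_sdiff_add_ncard_of_subset hsub
    (finite_almostNoncrossing m), noncrossingCount]
  congr 1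
  change {f : Fin (m + 2) → Fin (m + 2) | IsMatching f ∧ MinContains p1212 f}.ncard = _
  rw [← Set.ncard_image_of_injective _ extendFin_injective]
  congr 1
  ext F
  constructor
  · rintro ⟨f, ⟨hf, hc⟩, rfl⟩
    rw [minContains_p1212_iff hf] at hc
    exact ⟨⟨extendFin_mem_matchingsOn hf, hc.2⟩, fun h => h.2 hc.1⟩
  · rintro ⟨⟨hF, h1⟩, h2⟩
    obtain ⟨f, hf, rfl⟩ := exists_extendFin_eq hF
    refine ⟨f, ⟨hf, (minContains_p1212_iff hf).2 ⟨?_, h1⟩⟩, rfl⟩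
    by_contra h
    exact h2 ⟨hF, h⟩

lemma card_minContains_p1212_succ (n : ℕ) :
    (Nat.card {f : Fin (2 * (n + 1)) → Fin (2 * (n + 1)) //
      IsMatching f ∧ MinContains p1212 f} : ℚ) =
      (2 * n + 1) * catalan n - catalan (n + 1) := by
  have h := card_minContains_p1212_add (2 * n)
  rw [show 2 * n + 2 = 2 * (n + 1) by ring, noncrossingCount_even, noncrossingCount_even] at h
  rw [eq_sub_iff_add_eq]
  exact_mod_cast h

lemma card_minContains_p1212_zero :
    Nat.card {f : Fin (2 * 0) → Fin (2 * 0) // IsMatching f ∧ MinContains p1212 f} = 0 := by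
  have : IsEmpty {f : Fin (2 * 0) → Fin (2 * 0) // IsMatching f ∧ MinContains p1212 f} :=
    ⟨fun ⟨_, _, ⟨g, _⟩, _⟩ => (g 0).elim0⟩
  exact Nat.card_of_isEmpty

open PowerSeries in
lemma mk_catalan_eq :
    (PowerSeries.mk fun n => (catalan n : ℚ)) =
      1 + X * (PowerSeries.mk fun n => (catalan n : ℚ)) ^ 2 := by
  have h := congrArg (PowerSeries.map (Nat.castRingHom ℚ)) catalanSeries_sq_mul_X_add_one
  have e : PowerSeries.map (Nat.castRingHom ℚ) catalanSeries =
      PowerSeries.mk fun n => (catalan n : ℚ) := by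
    ext n
    simp [catalanSeries]
  simp only [map_add, map_mul, map_pow, map_one, PowerSeries.map_X, e] at h
  linear_combination -h

open PowerSeries in
lemma mk_card_minContains_p1212_eq :
    (PowerSeries.mk fun n =>
        (Nat.card {f : Fin (2 * n) → Fin (2 * n) //
          IsMatching f ∧ MinContains p1212 f} : ℚ)) =
      X * (2 * (X * d⁄dX ℚ (PowerSeries.mk fun n => (catalan n : ℚ))) +
        PowerSeries.mk fun n => (catalan n : ℚ)) -
      ((PowerSeries.mk fun n => (catalan n : ℚ)) - 1) := by
  ext n
  rcases n with _ | n
  · rw [coeff_mk, card_minContains_p1212_zero]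
    simp
  · rw [coeff_mk, card_minContains_p1212_succ, map_sub, map_sub, coeff_succ_X_mul, map_add,
      two_mul (X * d⁄dX ℚ _), map_add]
    rcases n with _ | n
    · simp [coeff_one]
    · rw [coeff_succ_X_mul, coeff_derivative]
      simp [coeff_one]
      ring

open PowerSeries in
theorem mu_1212_gf :
    (PowerSeries.mk fun n =>
        (Nat.card {f : Fin (2 * n) → Fin (2 * n) //
          IsMatching f ∧ MinContains p1212 f} : ℚ)) *
      ((1 - 2 * X * PowerSeries.mk fun n => (catalan n : ℚ)) *
        (1 - X * PowerSeries.mk fun n => (catalan n : ℚ))) =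
      X * ((PowerSeries.mk fun n => (catalan n : ℚ)) - 1) := by
  rw [mk_card_minContains_p1212_eq]
  have h := mk_catalan_eq
  set C : ℚ⟦X⟧ := PowerSeries.mk fun n => (catalan n : ℚ)
  have hd : d⁄dX ℚ C = C ^ 2 + 2 * X * C * d⁄dX ℚ C := by
    have h1 := congrArg (d⁄dX ℚ) h
    simp [pow_two] at h1
    linear_combination h1
  linear_combination 2 * X ^ 2 * (1 - X * C) * hd + ((2 * C - 1) * X - 1) * h
end

section
/- For n ≥ 1, the number of matchings of [2n] avoiding the juxtaposition pattern 11(τ+1) (a small edge followed by τ) equals Σ_{k=1}^{n} k!·binom(2n-k-1, k-1)·|M_{n-k}(τ)|, where M_m(τ) is the set of matchings of [2m] avoiding τ. -/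
def p11 : Fin 2 → Fin 2 := ![1, 0]

open Finset in
/-- The order embedding of `Fin m` onto the complement of the range of `e`. -/
noncomputable def complEmb {k m : ℕ} (e : Fin k ↪ Fin (k + m)) : Fin m ↪o Fin (k + m) :=
  ((univ.map e)ᶜ).orderEmbOfFin (by simp [card_compl])

theorem complEmb_ne {k m : ℕ} (e : Fin k ↪ Fin (k + m)) (j : Fin m) (i : Fin k) :
    complEmb e j ≠ e i := by
  intro h
  have := Finset.orderEmbOfFin_mem (Finset.univ.map e)ᶜ (by simp [Finset.card_compl]) j
  rw [Finset.mem_compl] at this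
  exact this (Finset.mem_map.2 ⟨i, Finset.mem_univ _, h.symm⟩)

theorem bijective_sumElim_complEmb {k m : ℕ} (e : Fin k ↪ Fin (k + m)) :
    Function.Bijective (Sum.elim e (complEmb e)) := by
  rw [Fintype.bijective_iff_injective_and_card]
  exact ⟨Function.Injective.sumElim e.injective (complEmb e).injective
    fun i j h => complEmb_ne e j i h.symm, by simp⟩

/-- The decomposition of the vertices into the `k` initial ones, the partners prescribed by `e`,
and the remaining ones. -/
noncomputable def vertexEquiv {k m : ℕ} (e : Fin k ↪ Fin (k + m)) :
    Fin k ⊕ Fin k ⊕ Fin m ≃ Fin (k + (k + m)) :=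
  ((Equiv.refl _).sumCongr (Equiv.ofBijective _ (bijective_sumElim_complEmb e))).trans
    finSumFinEquiv

theorem vertexEquiv_inl {k m : ℕ} (e : Fin k ↪ Fin (k + m)) (i : Fin k) :
    (vertexEquiv e (.inl i) : ℕ) = i := by
  simp [vertexEquiv]

theorem vertexEquiv_inr_inl {k m : ℕ} (e : Fin k ↪ Fin (k + m)) (i : Fin k) :
    (vertexEquiv e (.inr (.inl i)) : ℕ) = k + e i := by
  simp [vertexEquiv]

theorem vertexEquiv_inr_inr {k m : ℕ} (e : Fin k ↪ Fin (k + m)) (j : Fin m) :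
    (vertexEquiv e (.inr (.inr j)) : ℕ) = k + complEmb e j := by
  simp [vertexEquiv]

theorem vertexEquiv_inr_inr_lt {k m : ℕ} (e : Fin k ↪ Fin (k + m)) {j j' : Fin m} :
    vertexEquiv e (.inr (.inr j)) < vertexEquiv e (.inr (.inr j')) ↔ j < j' := by
  rw [Fin.lt_def, vertexEquiv_inr_inr, vertexEquiv_inr_inr, Nat.add_lt_add_iff_left,
    ← Fin.lt_def, OrderEmbedding.lt_iff_lt]

/-- Swap the two copies of `Fin k` and apply `h` to the rest. -/
def swapMap {k m : ℕ} (h : Fin m → Fin m) : Fin k ⊕ Fin k ⊕ Fin m → Fin k ⊕ Fin k ⊕ Fin m :=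
  Sum.elim (fun i => .inr (.inl i)) (Sum.elim .inl fun j => .inr (.inr (h j)))

/-- The matching joining the `k` initial vertices to the vertices prescribed by `e`, and matching
the remaining vertices according to `h`. -/
noncomputable def glue {k m : ℕ} (e : Fin k ↪ Fin (k + m)) (h : Fin m → Fin m) :
    Fin (k + (k + m)) → Fin (k + (k + m)) :=
  fun x => vertexEquiv e (swapMap h ((vertexEquiv e).symm x))

theorem glue_vertexEquiv {k m : ℕ} (e : Fin k ↪ Fin (k + m)) (h : Fin m → Fin m)
    (x : Fin k ⊕ Fin k ⊕ Fin m) :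
    glue e h (vertexEquiv e x) = vertexEquiv e (swapMap h x) := by
  simp [glue]

theorem isMatching_glue {k m : ℕ} (e : Fin k ↪ Fin (k + m)) {h : Fin m → Fin m}
    (hh : IsMatching h) : IsMatching (glue e h) := by
  constructor <;> intro x <;> obtain ⟨x, rfl⟩ := (vertexEquiv e).surjective x
  · rw [glue_vertexEquiv, glue_vertexEquiv]
    rcases x with i | i | j <;> simp [swapMap, hh.1 _]
  · rw [glue_vertexEquiv, (vertexEquiv e).injective.ne_iff]
    rcases x with i | i | j <;> simp [swapMap, hh.2 _]

/-- The first `k` vertices are left endpoints and the next one is a right endpoint. -/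
def InitialRun (k : ℕ) {N : ℕ} (f : Fin N → Fin N) : Prop :=
  (∀ i : Fin N, (i : ℕ) < k → k ≤ (f i : ℕ)) ∧ ∃ i : Fin N, (i : ℕ) < k ∧ (f i : ℕ) = k

theorem initialRun_glue {k m : ℕ} (e : Fin k ↪ Fin (k + m)) (he : ∃ i, (e i : ℕ) = 0)
    (h : Fin m → Fin m) : InitialRun k (glue e h) := by
  constructor
  · intro x hx
    obtain ⟨x, rfl⟩ := (vertexEquiv e).surjective x
    rw [glue_vertexEquiv]
    rcases x with i | i | j
    · simp [swapMap, vertexEquiv_inr_inl]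
    · rw [vertexEquiv_inr_inl] at hx; omega
    · rw [vertexEquiv_inr_inr] at hx; omega
  · obtain ⟨i, hi⟩ := he
    refine ⟨vertexEquiv e (.inl i), ?_, ?_⟩
    · rw [vertexEquiv_inl]; exact i.2
    · simp [glue_vertexEquiv, swapMap, vertexEquiv_inr_inl, hi]

theorem occurs_juxt_p11_iff {M N : ℕ} (τ : Fin M → Fin M) (f : Fin N → Fin N) :
    Occurs (juxt p11 τ) f ↔ ∃ a b : Fin N, a < b ∧ f a = b ∧ f b = a ∧
      ∃ g : Fin M → Fin N, StrictMono g ∧ (∀ p, b < g p) ∧ ∀ p, f (g p) = g (τ p) := by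
  have h0 : juxt p11 τ (Fin.castAdd M 0) = Fin.castAdd M 1 := by
    simp [juxt, p11]
  have h1 : juxt p11 τ (Fin.castAdd M 1) = Fin.castAdd M 0 := by
    simp [juxt, p11]
  have h2 (p : Fin M) : juxt p11 τ (Fin.natAdd 2 p) = Fin.natAdd 2 (τ p) := by
    simp [juxt]
  constructor
  · rintro ⟨g, hg, hf⟩
    refine ⟨g (Fin.castAdd M 0), g (Fin.castAdd M 1), hg ?_, ?_, ?_, fun p => g (Fin.natAdd 2 p),
      fun p q hpq => hg ?_, fun p => hg ?_, fun p => ?_⟩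
    · exact Nat.zero_lt_one
    · rw [hf, h0]
    · rw [hf, h1]
    · exact (Fin.natAdd_lt_natAdd_iff 2).2 hpq
    · rw [Fin.lt_def, Fin.val_natAdd, Fin.val_castAdd]; exact Nat.lt_add_right _ one_lt_two
    · rw [hf, h2]
  · rintro ⟨a, b, hab, ha, hb, g, hg, hbg, hf⟩
    refine ⟨Fin.append ![a, b] g, fun p q => ?_, fun p => ?_⟩
    · refine Fin.addCases (fun p => ?_) (fun p => ?_) p <;>
        refine Fin.addCases (fun q => ?_) (fun q => ?_) q <;> intro hpq
      · rw [Fin.append_left, Fin.append_left]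
        fin_cases p <;> fin_cases q
        · exact absurd hpq (lt_irrefl _)
        · exact hab
        · exact absurd hpq (Nat.not_lt_zero 1)
        · exact absurd hpq (lt_irrefl _)
      · rw [Fin.append_left, Fin.append_right]
        fin_cases p
        · exact hab.trans (hbg q)
        · exact hbg q
      · rw [Fin.lt_def, Fin.val_natAdd, Fin.val_castAdd] at hpq
        omega
      · rw [Fin.append_right, Fin.append_right]
        exact hg ((Fin.natAdd_lt_natAdd_iff 2).1 hpq)
    · refine Fin.addCases (fun p => ?_) (fun p => ?_) p
      · fin_cases p
        · exact (congrArg f (Fin.append_left _ _ 0)).trans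
            (ha.trans ((congrArg (Fin.append ![a, b] g) h0).trans (Fin.append_left _ _ 1)).symm)
        · exact (congrArg f (Fin.append_left _ _ 1)).trans
            (hb.trans ((congrArg (Fin.append ![a, b] g) h1).trans (Fin.append_left _ _ 0)).symm)
      · rw [h2, Fin.append_right, Fin.append_right, hf]

theorem occurs_juxt_p11_glue_iff {k m M : ℕ} (e : Fin k ↪ Fin (k + m))
    (he : ∃ i, (e i : ℕ) = 0) (h : Fin m → Fin m) (τ : Fin M → Fin M) :
    Occurs (juxt p11 τ) (glue e h) ↔ Occurs τ h := by
  rw [occurs_juxt_p11_iff]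
  constructor
  · rintro ⟨a, b, hab, ha, hb, g, hg, hbg, hf⟩
    have hkb : k ≤ (b : ℕ) := by
      by_contra! hlt
      have := (initialRun_glue e he h).1 b hlt
      rw [hb] at this
      rw [Fin.lt_def] at hab
      omega
    have hrest (p : Fin M) : ∃ j, g p = vertexEquiv e (.inr (.inr j)) := by
      obtain ⟨x, hx⟩ := (vertexEquiv e).surjective (g p)
      rcases x with i | i | j
      · have := hbg p
        rw [← hx, Fin.lt_def, vertexEquiv_inl] at this
        omega
      · have := hbg (τ p)
        rw [← hf, ← hx, glue_vertexEquiv, Fin.lt_def] at this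
        simp only [swapMap, Sum.elim_inr, Sum.elim_inl, vertexEquiv_inl] at this
        omega
      · exact ⟨j, hx.symm⟩
    choose g' hg' using hrest
    refine ⟨g', fun p q hpq => ?_, fun p => ?_⟩
    · have := hg hpq
      rwa [hg', hg', vertexEquiv_inr_inr_lt] at this
    · have := hf p
      rw [hg', hg', glue_vertexEquiv, (vertexEquiv e).injective.eq_iff] at this
      simpa [swapMap] using this
  · rintro ⟨g, hg, hf⟩
    obtain ⟨i, hi⟩ := he
    refine ⟨vertexEquiv e (.inl i), vertexEquiv e (.inr (.inl i)), ?_, ?_, ?_,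
      fun p => vertexEquiv e (.inr (.inr (g p))), fun p q hpq => ?_, fun p => ?_, fun p => ?_⟩
    · rw [Fin.lt_def, vertexEquiv_inl, vertexEquiv_inr_inl]; omega
    · simp [glue_vertexEquiv, swapMap]
    · simp [glue_vertexEquiv, swapMap]
    · exact (vertexEquiv_inr_inr_lt e).2 (hg hpq)
    · rw [Fin.lt_def, vertexEquiv_inr_inl, vertexEquiv_inr_inr]
      have := Fin.val_ne_of_ne (complEmb_ne e (g p) i)
      omega
    · simp [glue_vertexEquiv, swapMap, hf]

theorem glue_injective {k m : ℕ} {e e' : Fin k ↪ Fin (k + m)} {h h' : Fin m → Fin m}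
    (H : glue e h = glue e' h') : e = e' ∧ h = h' := by
  have hee : e = e' := by
    ext i
    have hi : vertexEquiv e (.inl i) = vertexEquiv e' (.inl i) := by
      ext; rw [vertexEquiv_inl, vertexEquiv_inl]
    have := congrFun H (vertexEquiv e (.inl i))
    rw [glue_vertexEquiv, hi, glue_vertexEquiv, Fin.ext_iff] at this
    simpa [swapMap, vertexEquiv_inr_inl] using this
  subst hee
  refine ⟨rfl, funext fun j => ?_⟩
  have := congrFun H (vertexEquiv e (.inr (.inr j)))
  rw [glue_vertexEquiv, glue_vertexEquiv, (vertexEquiv e).injective.eq_iff] at this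
  simpa [swapMap] using this

theorem exists_glue_eq {k m : ℕ} {f : Fin (k + (k + m)) → Fin (k + (k + m))}
    (hf : IsMatching f) (hk : InitialRun k f) :
    ∃ (e : Fin k ↪ Fin (k + m)) (h : Fin m → Fin m),
      (∃ i, (e i : ℕ) = 0) ∧ IsMatching h ∧ glue e h = f := by
  have hpartner (i : Fin k) : ∃ x : Fin (k + m), f (Fin.castAdd _ i) = Fin.natAdd k x := by
    have := hk.1 (Fin.castAdd _ i) i.2
    exact ⟨⟨f (Fin.castAdd _ i) - k, by omega⟩, by ext; simp; omega⟩
  choose e he using hpartner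
  have he_inj : Function.Injective e := by
    intro i j hij
    have : f (Fin.castAdd _ i) = f (Fin.castAdd _ j) := by rw [he, he, hij]
    simpa using hf.1.injective this
  let e' : Fin k ↪ Fin (k + m) := ⟨e, he_inj⟩
  have hleft (i : Fin k) : f (vertexEquiv e' (.inl i)) = vertexEquiv e' (.inr (.inl i)) := by
    have h1 : vertexEquiv e' (.inl i) = Fin.castAdd _ i := by ext; simp [vertexEquiv_inl]
    have h2 : vertexEquiv e' (.inr (.inl i)) = Fin.natAdd k (e i) := by
      ext; simp [vertexEquiv_inr_inl, e']
    rw [h1, h2, he]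
  have hright (i : Fin k) : f (vertexEquiv e' (.inr (.inl i))) = vertexEquiv e' (.inl i) := by
    rw [← hleft, hf.1]
  have hrest (j : Fin m) :
      ∃ j', f (vertexEquiv e' (.inr (.inr j))) = vertexEquiv e' (.inr (.inr j')) := by
    obtain ⟨x, hx⟩ := (vertexEquiv e').surjective (f (vertexEquiv e' (.inr (.inr j))))
    have hfx := congrArg f hx
    rw [hf.1] at hfx
    rcases x with i | i | j'
    · rw [hleft] at hfx; simp at hfx
    · rw [hright] at hfx; simp at hfx
    · exact ⟨j', hx.symm⟩
  choose h hh using hrest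
  refine ⟨e', h, ?_, ⟨fun j => ?_, fun j hj => ?_⟩, funext fun x => ?_⟩
  · obtain ⟨x, hx, hfx⟩ := hk.2
    refine ⟨⟨x, hx⟩, ?_⟩
    have := congrArg Fin.val (he ⟨x, hx⟩)
    have hcast : Fin.castAdd (k + m) ⟨x, hx⟩ = x := rfl
    rw [hcast, hfx] at this
    simpa [e'] using this
  · have := hf.1 (vertexEquiv e' (.inr (.inr j)))
    rw [hh, hh] at this
    simpa using this
  · exact hf.2 (vertexEquiv e' (.inr (.inr j))) (by rw [hh, hj])
  · obtain ⟨x, rfl⟩ := (vertexEquiv e').surjective x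
    rw [glue_vertexEquiv]
    rcases x with i | i | j
    · exact (hleft i).symm
    · exact (hright i).symm
    · exact (hh j).symm

theorem card_initialRun_avoids {k m M N : ℕ} (hN : N = k + (k + m)) (τ : Fin M → Fin M) :
    Nat.card {f : Fin N → Fin N // (IsMatching f ∧ Avoids (juxt p11 τ) f) ∧ InitialRun k f} =
      Nat.card {e : Fin k ↪ Fin (k + m) // ∃ i, (e i : ℕ) = 0} *
        Nat.card {h : Fin m → Fin m // IsMatching h ∧ Avoids τ h} := by
  subst hN
  rw [← Nat.card_prod]
  symm
  refine Nat.card_congr (Equiv.ofBijective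
    (fun p => ⟨glue p.1.1 p.2.1, ⟨isMatching_glue _ p.2.2.1,
      (occurs_juxt_p11_glue_iff _ p.1.2 _ τ).not.2 p.2.2.2⟩, initialRun_glue _ p.1.2 _⟩) ⟨?_, ?_⟩)
  · rintro ⟨⟨e, he⟩, ⟨h, hh⟩⟩ ⟨⟨e', he'⟩, ⟨h', hh'⟩⟩ H
    obtain ⟨rfl, rfl⟩ := glue_injective (Subtype.ext_iff.1 H)
    rfl
  · rintro ⟨f, ⟨hf, hav⟩, hk⟩
    obtain ⟨e, h, he, hh, rfl⟩ := exists_glue_eq hf hk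
    exact ⟨⟨⟨e, he⟩, ⟨h, hh, (occurs_juxt_p11_glue_iff e he h τ).not.1 hav⟩⟩, rfl⟩

theorem card_embedding_zero_mem_range (k L : ℕ) (hk : 1 ≤ k) :
    Nat.card {e : Fin k ↪ Fin (L + 1) // ∃ i, (e i : ℕ) = 0} =
      k.factorial * L.choose (k - 1) := by
  classical
  have hcompl : Fintype.card {e : Fin k ↪ Fin (L + 1) // ¬ ∃ i, (e i : ℕ) = 0} =
      L.descFactorial k := by
    have : Fintype.card (Fin k ↪ Fin L) = L.descFactorial k := by simp
    rw [← this]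
    symm
    refine Fintype.card_congr (Equiv.ofBijective
      (fun e => ⟨e.trans (Fin.succEmb L), by simp⟩) ⟨fun e e' H => ?_, ?_⟩)
    · ext i
      have := congrArg (fun x => (x.1 i : ℕ)) H
      simpa using this
    · rintro ⟨e, he⟩
      push Not at he
      refine ⟨⟨fun i => (e i).pred fun h => he i (by simp [h]), fun i j hij => ?_⟩, ?_⟩
      · simpa using hij
      · ext i
        have := Nat.pos_of_ne_zero (he i)
        change (e i : ℕ) - 1 + 1 = e i
        omega
  have htotal := Fintype.card_subtype_compl (fun e : Fin k ↪ Fin (L + 1) => ∃ i, (e i : ℕ) = 0)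
  have hle := Fintype.card_subtype_le (fun e : Fin k ↪ Fin (L + 1) => ∃ i, (e i : ℕ) = 0)
  rw [hcompl] at htotal
  rw [Nat.card_eq_fintype_card]
  simp only [Fintype.card_embedding_eq, Fintype.card_fin] at htotal hle
  obtain ⟨k, rfl⟩ := Nat.exists_eq_add_of_le' hk
  rw [Nat.descFactorial_eq_factorial_mul_choose, Nat.descFactorial_eq_factorial_mul_choose,
    Nat.choose_succ_succ, mul_add] at htotal
  rw [Nat.descFactorial_eq_factorial_mul_choose, Nat.choose_succ_succ, mul_add] at hle
  simp only [Nat.add_sub_cancel, Nat.succ_eq_add_one] at *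
  omega

theorem InitialRun.unique {k l N : ℕ} {f : Fin N → Fin N} (hk : InitialRun k f)
    (hl : InitialRun l f) : k = l := by
  obtain ⟨i, hi, hfi⟩ := hk.2
  obtain ⟨j, hj, hfj⟩ := hl.2
  by_contra hne
  rcases Nat.lt_or_gt_of_ne hne with h | h
  · have := hl.1 i (by omega); omega
  · have := hk.1 j (by omega); omega

theorem exists_initialRun {n : ℕ} (hn : 1 ≤ n) {f : Fin (2 * n) → Fin (2 * n)}
    (hf : IsMatching f) : ∃ k ∈ Finset.Icc 1 n, InitialRun k f := by
  classical
  have hex : ∃ k, ∃ j : Fin (2 * n), (j : ℕ) = k ∧ f j < j := by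
    let z : Fin (2 * n) := ⟨0, by omega⟩
    refine ⟨f z, f z, rfl, ?_⟩
    rw [hf.1 z]
    have := Fin.val_ne_of_ne (hf.2 z)
    rw [Fin.lt_def]
    simp only [z] at *
    omega
  obtain ⟨j, hj, hfj⟩ := Nat.find_spec hex
  have hmin : ∀ i : Fin (2 * n), (i : ℕ) < j → i < f i := by
    intro i hi
    by_contra hlt
    have := Nat.find_min hex (m := i) (by omega)
    exact this ⟨i, rfl, lt_of_le_of_ne (not_lt.1 hlt) (hf.2 i)⟩
  have hrun : InitialRun j f := by
    refine ⟨fun i hi => ?_, f j, hfj, by rw [hf.1]⟩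
    by_contra! hlt
    have h1 := hmin i hi
    have h2 := hmin (f i) hlt
    rw [hf.1] at h2
    exact absurd h1 (not_lt.2 h2.le)
  refine ⟨j, Finset.mem_Icc.2 ⟨by rw [Fin.lt_def] at hfj; omega, ?_⟩, hrun⟩
  have hcard : (Finset.Iio j).card ≤ (Finset.Ici j).card :=
    Finset.card_le_card_of_injOn f (fun i hi => by
      simp only [Finset.coe_Iio, Set.mem_Iio, Finset.coe_Ici, Set.mem_Ici] at *
      exact hrun.1 i hi) hf.1.injective.injOn
  rw [Fin.card_Iio, Fin.card_Ici] at hcard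
  omega

open Finset in
theorem card_avoid_edge_juxt (n t : ℕ) (hn : 1 ≤ n)
    (τ : Fin (2 * t) → Fin (2 * t)) (hτ : IsMatching τ) :
    Nat.card {f : Fin (2 * n) → Fin (2 * n) // IsMatching f ∧ Avoids (juxt p11 τ) f} =
      ∑ k ∈ Icc 1 n,
        Nat.factorial k * Nat.choose (2 * n - k - 1) (k - 1) *
          Nat.card {h : Fin (2 * (n - k)) → Fin (2 * (n - k)) //
            IsMatching h ∧ Avoids τ h} := by
  classical
  have hsplit : Nat.card {f : Fin (2 * n) → Fin (2 * n) //
      IsMatching f ∧ Avoids (juxt p11 τ) f} = ∑ k ∈ Icc 1 n,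
        Nat.card {f : Fin (2 * n) → Fin (2 * n) //
          (IsMatching f ∧ Avoids (juxt p11 τ) f) ∧ InitialRun k f} := by
    simp only [Nat.card_eq_fintype_card, Fintype.card_subtype]
    rw [← card_biUnion]
    · congr 1
      ext f
      simp only [mem_filter, mem_univ, true_and, mem_biUnion]
      refine ⟨fun hf => ?_, fun ⟨_, _, hf, _⟩ => hf⟩
      obtain ⟨k, hk, hrun⟩ := exists_initialRun hn hf.1
      exact ⟨k, hk, hf, hrun⟩
    · intro k _ l _ hkl
      refine disjoint_left.2 fun f hfk hfl => hkl ?_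
      exact (mem_filter.1 hfk).2.2.unique (mem_filter.1 hfl).2.2
  rw [hsplit]
  refine sum_congr rfl fun k hk => ?_
  rw [mem_Icc] at hk
  rw [card_initialRun_avoids (m := 2 * (n - k)) (by omega) τ]
  obtain ⟨L, hL⟩ : ∃ L, k + 2 * (n - k) = L + 1 := ⟨k + 2 * (n - k) - 1, by omega⟩
  rw [hL, card_embedding_zero_mem_range k L hk.1, show 2 * n - k - 1 = L by omega]
end
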